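/- arXiv:2108.00914 — 3 statements merged into one kernel-verified Lean document; each statement's English description precedes it below -/
import Mathlib

section
/- Let M = (E, r) be a matroid on a finite ground set E of size m with rank r(E) = k. Then min over bijections σ : E → {1,…,m} of ∑_{i=1}^m r(E_{i,σ}) equals k(k+1)/2 + min over bases B of M and bijections π : B → {1,…,k} of ∑_{e ∈ E \ B} max C(B,e)_π, where C(B,e)_π = {π(e′) : e′ ∈ C(B,e) − e} and the maximum of the empty set is taken to be 0. -/
/-- Rank-function axioms for a matroid on ground set `α`. -/
def IsRankFunction {α : Type*} [DecidableEq α] (r : Finset α → ℕ) : Prop :=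
  r ∅ = 0 ∧
  (∀ A B : Finset α, A ⊆ B → r A ≤ r B) ∧
  (∀ A B : Finset α, r (A ∪ B) + r (A ∩ B) ≤ r A + r B) ∧
  (∀ (A : Finset α) (e : α), r (insert e A) ≤ r A + 1)

/-- The prefix set `E_{i,σ} = {e : σ(e) ≤ i}`, where the bijection `σ : α ≃ Fin m`
is interpreted as a labeling by `{1,…,m}` via `e ↦ (σ e) + 1`. -/
def prefixSet {α : Type*} [Fintype α] [DecidableEq α] {m : ℕ} (σ : α ≃ Fin m) (i : ℕ) :
    Finset α :=
  Finset.univ.filter fun e => (σ e : ℕ) < i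

/-- For a basis `B` (a set of rank `k = |B|`), the set `C(B,e) − e` of basis elements in the
fundamental circuit of `e` with respect to `B`: those `b ∈ B` for which `B − b + e` is
independent, i.e. has rank `k`. -/
def fundCircuitErase {α : Type*} [DecidableEq α] (r : Finset α → ℕ) (B : Finset α)
    (k : ℕ) (e : α) : Finset α :=
  B.filter fun b => r (insert e (B.erase b)) = k

namespace IsRankFunction

variable {α : Type*} [DecidableEq α] {r : Finset α → ℕ}

theorem mono (hr : IsRankFunction r) {A B : Finset α} (h : A ⊆ B) : r A ≤ r B :=
  hr.2.1 A B h

theorem rank_insert_le (hr : IsRankFunction r) (A : Finset α) (e : α) :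
    r (insert e A) ≤ r A + 1 :=
  hr.2.2.2 A e

/-- Diminishing returns, in the form of submodularity relative to sub- and supersets. -/
theorem submodular_of_subset (hr : IsRankFunction r) {A B U I : Finset α}
    (hU : U ⊆ A ∪ B) (hI : I ⊆ A ∩ B) : r U + r I ≤ r A + r B :=
  (add_le_add (hr.mono hU) (hr.mono hI)).trans (hr.2.2.1 A B)

theorem rank_union_le_add_card (hr : IsRankFunction r) (A T : Finset α) :
    r (A ∪ T) ≤ r A + T.card := by
  induction T using Finset.induction_on with
  | empty => simp
  | insert a T ha ih =>
    rw [Finset.union_insert, Finset.card_insert_of_notMem ha]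
    have := hr.rank_insert_le (A ∪ T) a
    omega

theorem rank_le_card (hr : IsRankFunction r) (A : Finset α) : r A ≤ A.card := by
  have := hr.rank_union_le_add_card ∅ A
  rwa [Finset.empty_union, hr.1, zero_add] at this

/-- Subsets of independent sets are independent. -/
theorem rank_eq_card_of_subset (hr : IsRankFunction r) {A B : Finset α} (hAB : A ⊆ B)
    (hB : r B = B.card) : r A = A.card := by
  have h1 := hr.rank_union_le_add_card A (B \ A)
  rw [Finset.union_sdiff_of_subset hAB] at h1
  have h2 := Finset.card_sdiff_add_card_eq_card hAB
  have h3 := hr.rank_le_card A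
  omega

theorem rank_union_le_of_forall_insert (hr : IsRankFunction r) (A S : Finset α)
    (h : ∀ x ∈ S, r (insert x A) ≤ r A) : r (A ∪ S) ≤ r A := by
  induction S using Finset.induction_on with
  | empty => simp
  | insert a S ha ih =>
    have h1 := ih fun x hx => h x (Finset.mem_insert_of_mem hx)
    have h2 := h a (Finset.mem_insert_self a S)
    have h3 : r (A ∪ insert a S) + r A ≤ r (A ∪ S) + r (insert a A) :=
      hr.submodular_of_subset (by intro; simp; tauto) (by intro; simp; tauto)
    omega

/-- If none of the elements of `T` lies in the fundamental circuit of `x`, then adjoining `x` to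
`B \ T` does not increase its rank. -/
theorem rank_insert_sdiff_add_card_le (hr : IsRankFunction r) {B T : Finset α} {x : α}
    (hTB : T ⊆ B) (hB : r (insert x B) ≤ r B) (h : ∀ b ∈ T, r (insert x (B.erase b)) < r B) :
    r (insert x (B \ T)) + T.card ≤ r B := by
  induction T using Finset.induction_on with
  | empty => simpa using hB
  | insert b T hb ih =>
    have h1 := ih (fun y hy => hTB (Finset.mem_insert_of_mem hy))
      fun y hy => h y (Finset.mem_insert_of_mem hy)
    have h2 := h b (Finset.mem_insert_self b T)
    have h3 : r B + r (insert x (B \ insert b T)) ≤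
        r (insert x (B \ T)) + r (insert x (B.erase b)) := by
      refine hr.submodular_of_subset (fun y hy => ?_) (fun y hy => ?_)
      · by_cases hyb : y = b
        · subst hyb; simp [hy, hb]
        · simp [hy, hyb]
      · simp only [Finset.mem_insert, Finset.mem_sdiff, Finset.mem_inter, Finset.mem_erase] at hy ⊢
        tauto
    rw [Finset.card_insert_of_notMem hb]
    omega

end IsRankFunction

theorem bijOn_of_injOn_card_eq {α : Type*} {B : Finset α} {π : α → ℕ}
    (hmaps : ∀ b ∈ B, π b ∈ Finset.Icc 1 B.card) (hinj : Set.InjOn π B) :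
    Set.BijOn π B (Set.Icc 1 B.card) := by
  refine ⟨fun b hb => by simpa using hmaps b hb, hinj, ?_⟩
  have := Finset.surjOn_of_injOn_of_card_le π (s := B) (t := Finset.Icc 1 B.card)
    hmaps hinj (by simp)
  simpa using this

theorem sum_of_bijOn_Icc {α : Type*} {B : Finset α} {π : α → ℕ} {k : ℕ}
    (h : Set.BijOn π B (Set.Icc 1 k)) : ∑ b ∈ B, π b = k * (k + 1) / 2 := by
  classical
  have himg : B.image π = Finset.Icc 1 k := by
    apply Finset.coe_injective
    simpa using h.image_eq
  rw [← Finset.sum_image (f := fun x => x) (fun a ha b hb => h.injOn ha hb), himg]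
  have h2 := Finset.sum_range_id_mul_two (k + 1)
  have h3 : ∑ i ∈ Finset.range (k + 1), i = ∑ i ∈ Finset.Icc 1 k, i := by
    rw [Finset.range_eq_Ico, Finset.sum_eq_sum_Ico_succ_bot (by omega)]
    simp only [zero_add]
    rfl
  rw [h3, Nat.add_sub_cancel, mul_comm (k + 1)] at h2
  omega

theorem exists_equiv_fin_of_key {α : Type*} [Fintype α] {m : ℕ} (hm : Fintype.card α = m)
    (K : α → ℕ) :
    ∃ σ : α ≃ Fin m, ∀ x y, σ x ≤ σ y → K x ≤ K y := by
  let e := Fintype.equivFinOfCardEq hm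
  refine ⟨e.trans (Tuple.sort (K ∘ e.symm)).symm, fun x y h => ?_⟩
  simpa using Tuple.monotone_sort (K ∘ e.symm) h

section Layout

variable {α : Type*} [Fintype α] [DecidableEq α] {m : ℕ}

theorem mem_prefixSet {σ : α ≃ Fin m} {i : ℕ} {e : α} :
    e ∈ prefixSet σ i ↔ (σ e : ℕ) < i := by
  simp [prefixSet]

theorem prefixSet_mono (σ : α ≃ Fin m) {i j : ℕ} (h : i ≤ j) :
    prefixSet σ i ⊆ prefixSet σ j := fun _ he =>
  mem_prefixSet.2 ((mem_prefixSet.1 he).trans_le h)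

theorem prefixSet_succ (σ : α ≃ Fin m) (e : α) :
    prefixSet σ (σ e + 1) = insert e (prefixSet σ (σ e)) := by
  ext x
  rw [Finset.mem_insert, mem_prefixSet, mem_prefixSet, ← σ.injective.eq_iff, Fin.ext_iff]
  omega

theorem prefixSet_self (σ : α ≃ Fin m) : prefixSet σ m = Finset.univ := by
  ext x
  simp [mem_prefixSet]

theorem sum_range_prefixSet (σ : α ≃ Fin m) (r : Finset α → ℕ) :
    ∑ i ∈ Finset.range m, r (prefixSet σ (i + 1)) = ∑ e, r (prefixSet σ (σ e + 1)) := by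
  rw [Finset.sum_range]
  exact (σ.sum_comp fun i : Fin m => r (prefixSet σ (i + 1))).symm

/-- The elements at which the rank of the prefixes of `σ` increases. -/
def greedyBasis (r : Finset α → ℕ) (σ : α ≃ Fin m) : Finset α :=
  Finset.univ.filter fun e => r (prefixSet σ (σ e)) < r (prefixSet σ (σ e + 1))

theorem mem_greedyBasis {r : Finset α → ℕ} {σ : α ≃ Fin m} {e : α} :
    e ∈ greedyBasis r σ ↔ r (prefixSet σ (σ e)) < r (prefixSet σ (σ e + 1)) := by
  simp [greedyBasis]

theorem rank_and_card_greedyBasis_inter_prefixSet {r : Finset α → ℕ}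
    (hr : IsRankFunction r) (σ : α ≃ Fin m) {i : ℕ} (hi : i ≤ m) :
    r (greedyBasis r σ ∩ prefixSet σ i) = r (prefixSet σ i) ∧
      (greedyBasis r σ ∩ prefixSet σ i).card = r (prefixSet σ i) := by
  induction i with
  | zero =>
    have : prefixSet σ 0 = ∅ := by ext; simp [mem_prefixSet]
    simp [this, hr.1]
  | succ i ih =>
    obtain ⟨h1, h2⟩ := ih (by omega)
    obtain ⟨e, he⟩ := σ.surjective ⟨i, hi⟩
    have hei : (σ e : ℕ) = i := by rw [he]
    subst hei
    have hnot : e ∉ prefixSet σ (σ e) := by simp [mem_prefixSet]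
    by_cases heB : e ∈ greedyBasis r σ
    · have hlt := mem_greedyBasis.1 heB
      have hle := hr.rank_insert_le (prefixSet σ (σ e)) e
      rw [prefixSet_succ] at hlt ⊢
      rw [Finset.inter_insert_of_mem heB, Finset.card_insert_of_notMem (by simp [hnot])]
      have h3 := hr.rank_insert_le (greedyBasis r σ ∩ prefixSet σ (σ e)) e
      have h4 : r (insert e (prefixSet σ (σ e))) + r (greedyBasis r σ ∩ prefixSet σ (σ e)) ≤
          r (insert e (greedyBasis r σ ∩ prefixSet σ (σ e))) + r (prefixSet σ (σ e)) :=
        hr.submodular_of_subset (by intro; simp; tauto) (by intro; simp; tauto)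
      omega
    · have hge := fun h => heB (mem_greedyBasis.2 h)
      have hmono := hr.mono (prefixSet_mono σ (Nat.le_succ (σ e : ℕ)))
      have heq : r (prefixSet σ (σ e + 1)) = r (prefixSet σ (σ e)) :=
        le_antisymm (not_lt.1 hge) hmono
      rw [heq, prefixSet_succ, Finset.inter_insert_of_notMem heB]
      exact ⟨h1, h2⟩

/-- Any layout does at least as badly as its greedy basis, ordered by rank. -/
theorem exists_basis_le_layout {r : Finset α → ℕ} (hr : IsRankFunction r) {k : ℕ}
    (hk : r Finset.univ = k) (σ : α ≃ Fin m) :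
    ∃ (B : Finset α) (π : α → ℕ), B.card = k ∧ r B = k ∧ Set.BijOn π B (Set.Icc 1 k) ∧
      k * (k + 1) / 2 + ∑ e ∈ Finset.univ \ B, (fundCircuitErase r B k e).sup π ≤
        ∑ i ∈ Finset.range m, r (prefixSet σ (i + 1)) := by
  have hfull := rank_and_card_greedyBasis_inter_prefixSet hr σ le_rfl
  rw [prefixSet_self, Finset.inter_univ, hk] at hfull
  obtain ⟨hrank, hcard⟩ := hfull
  have hlt : ∀ e b, b ∈ greedyBasis r σ → σ e < σ b →
      r (prefixSet σ (σ e + 1)) < r (prefixSet σ (σ b + 1)) := fun e b hb h =>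
    (hr.mono (prefixSet_mono σ (Nat.succ_le_of_lt h))).trans_lt (mem_greedyBasis.1 hb)
  have hbij : Set.BijOn (fun e => r (prefixSet σ (σ e + 1))) (greedyBasis r σ)
      (Set.Icc 1 k) := by
    rw [← hcard]
    refine bijOn_of_injOn_card_eq (fun b hb => ?_) (fun b hb c hc h => ?_)
    · rw [hcard, ← hk]
      exact Finset.mem_Icc.2
        ⟨Nat.one_le_of_lt (mem_greedyBasis.1 hb), hr.mono (Finset.subset_univ _)⟩
    · rcases lt_trichotomy (σ b) (σ c) with hbc | hbc | hbc
      · exact absurd h (hlt b c hc hbc).ne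
      · exact σ.injective hbc
      · exact absurd h (hlt c b hb hbc).ne'
  refine ⟨greedyBasis r σ, fun e => r (prefixSet σ (σ e + 1)), hcard, hrank, hbij, ?_⟩
  rw [sum_range_prefixSet, ← Finset.sum_sdiff (Finset.subset_univ (greedyBasis r σ)),
    sum_of_bijOn_Icc hbij, add_comm]
  refine Nat.add_le_add_right (Finset.sum_le_sum fun e he => Finset.sup_le fun b hb => ?_) _
  obtain ⟨hbB, hb⟩ := Finset.mem_filter.1 hb
  by_contra! hcon
  have heb : σ e < σ b := by
    by_contra! hbe
    exact absurd hcon (not_lt.2 (hr.mono (prefixSet_mono σ (Nat.succ_le_succ hbe))))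
  have hpre := (rank_and_card_greedyBasis_inter_prefixSet hr σ (σ b).is_lt.le).1
  have hcard_erase := Finset.card_erase_of_mem hbB
  have hpos := Finset.card_pos.2 ⟨b, hbB⟩
  have h1 := hr.rank_le_card ((greedyBasis r σ).erase b)
  have h2 : r (insert e ((greedyBasis r σ).erase b)) +
      r (greedyBasis r σ ∩ prefixSet σ (σ b)) ≤
      r ((greedyBasis r σ).erase b) + r (prefixSet σ (σ b)) := by
    refine hr.submodular_of_subset (fun x hx => ?_) (fun x hx => ?_)
    · rcases Finset.mem_insert.1 hx with rfl | hx
      · exact Finset.mem_union_right _ (mem_prefixSet.2 heb)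
      · exact Finset.mem_union_left _ hx
    · obtain ⟨hxB, hx⟩ := Finset.mem_inter.1 hx
      refine Finset.mem_inter.2 ⟨Finset.mem_erase.2 ⟨?_, hxB⟩, hx⟩
      rintro rfl
      exact lt_irrefl _ (mem_prefixSet.1 hx)
  omega

/-- The elements of label at most `j`, where a nonbasis element is labelled by the maximum of its
fundamental circuit, have rank at most `j`. -/
theorem rank_filter_label_le {r : Finset α → ℕ} (hr : IsRankFunction r) {k : ℕ}
    (hk : r Finset.univ = k) {B : Finset α} {π : α → ℕ} (hcard : B.card = k) (hB : r B = k)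
    (hπ : Set.BijOn π B (Set.Icc 1 k)) (j : ℕ) :
    r (Finset.univ.filter fun x =>
      (if x ∈ B then π x else (fundCircuitErase r B k x).sup π) ≤ j) ≤ j := by
  set S := Finset.univ.filter fun x =>
    (if x ∈ B then π x else (fundCircuitErase r B k x).sup π) ≤ j with hS
  set A := B.filter fun b => π b ≤ j with hA
  have hAB : A ⊆ B := Finset.filter_subset _ _
  have hrA : r A = A.card := hr.rank_eq_card_of_subset hAB (by omega)
  have hAj : A.card ≤ j := by
    have : A.card ≤ (Finset.Icc 1 j).card := by
      refine Finset.card_le_card_of_injOn π (fun b hb => ?_) (hπ.injOn.mono (by exact_mod_cast hAB))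
      obtain ⟨hbB, hbj⟩ := Finset.mem_filter.1 hb
      simpa using And.intro (hπ.mapsTo hbB).1 hbj
    simpa using this
  have hspan : r (A ∪ S) ≤ r A := by
    refine hr.rank_union_le_of_forall_insert A S fun x hx => ?_
    have hxj := (Finset.mem_filter.1 hx).2
    by_cases hxB : x ∈ B
    · rw [if_pos hxB] at hxj
      rw [Finset.insert_eq_of_mem (Finset.mem_filter.2 ⟨hxB, hxj⟩)]
    · rw [if_neg hxB] at hxj
      have h1 := hr.rank_insert_sdiff_add_card_le (B := B) (T := B \ A) (x := x)
        Finset.sdiff_subset (by rw [hB, ← hk]; exact hr.mono (Finset.subset_univ _))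
        (fun b hb => by
          obtain ⟨hbB, hbA⟩ := Finset.mem_sdiff.1 hb
          refine lt_of_le_of_ne (by rw [hB, ← hk]; exact hr.mono (Finset.subset_univ _)) ?_
          intro heq
          refine hbA (Finset.mem_filter.2 ⟨hbB, le_trans ?_ hxj⟩)
          exact Finset.le_sup (f := π) (Finset.mem_filter.2 ⟨hbB, heq.trans hB⟩))
      rw [Finset.sdiff_sdiff_eq_self hAB] at h1
      have h2 := Finset.card_sdiff_add_card_eq_card hAB
      omega
  have := hr.mono (Finset.subset_union_right (s₁ := A) (s₂ := S))
  omega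

/-- Placing every nonbasis element right after its fundamental circuit gives a good layout. -/
theorem exists_layout_le_basis {r : Finset α → ℕ} (hr : IsRankFunction r) {k : ℕ}
    (hm : Fintype.card α = m) (hk : r Finset.univ = k) {B : Finset α} {π : α → ℕ}
    (hcard : B.card = k) (hB : r B = k) (hπ : Set.BijOn π B (Set.Icc 1 k)) :
    ∃ σ : α ≃ Fin m, ∑ i ∈ Finset.range m, r (prefixSet σ (i + 1)) ≤
      k * (k + 1) / 2 + ∑ e ∈ Finset.univ \ B, (fundCircuitErase r B k e).sup π := by
  obtain ⟨σ, hσ⟩ := exists_equiv_fin_of_key hm fun x =>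
    if x ∈ B then π x else (fundCircuitErase r B k x).sup π
  refine ⟨σ, ?_⟩
  have hle : ∀ e, r (prefixSet σ (σ e + 1)) ≤
      if e ∈ B then π e else (fundCircuitErase r B k e).sup π := fun e => by
    refine le_trans (hr.mono fun x hx => ?_) (rank_filter_label_le hr hk hcard hB hπ _)
    exact Finset.mem_filter.2
      ⟨Finset.mem_univ _, hσ x e (Nat.lt_succ_iff.1 (mem_prefixSet.1 hx))⟩
  rw [sum_range_prefixSet, ← Finset.sum_sdiff (Finset.subset_univ B), ← sum_of_bijOn_Icc hπ,
    add_comm]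
  refine add_le_add (Finset.sum_le_sum fun e he => ?_) (Finset.sum_le_sum fun e he => ?_)
  · simpa [he] using hle e
  · simpa [(Finset.mem_sdiff.1 he).2] using hle e

end Layout

theorem stmt_4 {α : Type*} [Fintype α] [DecidableEq α] {m k : ℕ}
    (hm : Fintype.card α = m) (r : Finset α → ℕ) (hr : IsRankFunction r)
    (hk : r Finset.univ = k) :
    sInf {v : ℕ | ∃ σ : α ≃ Fin m, v = ∑ i ∈ Finset.range m, r (prefixSet σ (i + 1))} =
      k * (k + 1) / 2 +
        sInf {v : ℕ | ∃ (B : Finset α) (π : α → ℕ),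
          B.card = k ∧ r B = k ∧ Set.BijOn π ↑B (Set.Icc 1 k) ∧
          v = ∑ e ∈ Finset.univ \ B, (fundCircuitErase r B k e).sup π} := by
  apply le_antisymm
  · obtain ⟨B, π, hcard, hB, hπ, -⟩ :=
      exists_basis_le_layout hr hk (Fintype.equivFinOfCardEq hm)
    obtain ⟨B, π, hcard, hB, hπ, hv⟩ := Nat.sInf_mem (s := {v : ℕ | ∃ (B : Finset α) (π : α → ℕ),
      B.card = k ∧ r B = k ∧ Set.BijOn π ↑B (Set.Icc 1 k) ∧
      v = ∑ e ∈ Finset.univ \ B, (fundCircuitErase r B k e).sup π}) ⟨_, B, π, hcard, hB, hπ, rfl⟩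
    obtain ⟨σ, hσ⟩ := exists_layout_le_basis hr hm hk hcard hB hπ
    rw [hv]
    exact le_trans (Nat.sInf_le ⟨σ, rfl⟩) hσ
  · obtain ⟨σ, hv⟩ := Nat.sInf_mem (s := {v : ℕ | ∃ σ : α ≃ Fin m,
      v = ∑ i ∈ Finset.range m, r (prefixSet σ (i + 1))}) ⟨_, Fintype.equivFinOfCardEq hm, rfl⟩
    obtain ⟨B, π, hcard, hB, hπ, hle⟩ := exists_basis_le_layout hr hk σ
    rw [hv]
    refine le_trans (Nat.add_le_add_left ?_ _) hle
    exact Nat.sInf_le ⟨B, π, hcard, hB, hπ, rfl⟩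
end

section
/- Let E be a finite set with |E| = m and f : 2^E → ℝ≥0 a monotone submodular function with f(S) = 0 if and only if S = ∅. Suppose ∅ = Π_0 ⊊ Π_1 ⊊ ⋯ ⊊ Π_s = E is a chain such that for each 1 ≤ i ≤ s, both Π_{i−1} and Π_i minimize X ↦ f(X) − λ_i|X| over all X ⊆ E, where λ_i = (f(Π_i) − f(Π_{i−1})) / (|Π_i| − |Π_{i−1}|). Then for every bijection σ : E → {1,…,m}: 2 · ∑_{k=1}^m f(E_{k,σ}) ≥ (m+1)·f(E) − ∑_{i=1}^s ( f(Π_i)|Π_{i−1}| − f(Π_{i−1})|Π_i| ). -/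
theorem card_prefixSet {α : Type*} [Fintype α] [DecidableEq α] {m : ℕ} (σ : α ≃ Fin m) {k : ℕ}
    (hk : k ≤ m) : (prefixSet σ k).card = k := by
  have h : (prefixSet σ k).map σ.toEmbedding = Finset.univ.filter fun j : Fin m => (j : ℕ) < k := by
    ext j
    simp [prefixSet]
  rw [← Finset.card_map σ.toEmbedding, h, Fin.card_filter_val_lt, min_eq_right hk]

theorem two_mul_sum_range_affine (c l : ℝ) (d : ℕ) :
    2 * ∑ k ∈ Finset.range d, (c + l * ((k : ℝ) + 1)) = 2 * d * c + l * d * (d + 1) := by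
  induction d with
  | zero => simp
  | succ d ih =>
    rw [Finset.sum_range_succ, mul_add, ih]
    push_cast
    ring

theorem stmt_9 {α : Type*} [Fintype α] [DecidableEq α] {m s : ℕ}
    (hm : Fintype.card α = m) (f : Finset α → ℝ)
    (hnn : ∀ S : Finset α, 0 ≤ f S)
    (hmono : ∀ S T : Finset α, S ⊆ T → f S ≤ f T)
    (hsub : ∀ S T : Finset α, f (S ∪ T) + f (S ∩ T) ≤ f S + f T)
    (hzero : ∀ A : Finset α, f A = 0 ↔ A = ∅)
    (hs : 1 ≤ s) (P : ℕ → Finset α)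
    (hP0 : P 0 = ∅) (hPs : P s = Finset.univ)
    (hchain : ∀ i < s, P i ⊂ P (i + 1))
    (lam : ℕ → ℝ)
    (hlam : ∀ i < s,
      lam (i + 1) = (f (P (i + 1)) - f (P i)) / (((P (i + 1)).card : ℝ) - ((P i).card : ℝ)))
    (hmin : ∀ i < s, ∀ X : Finset α,
      (f (P i) - lam (i + 1) * ((P i).card : ℝ) ≤ f X - lam (i + 1) * (X.card : ℝ)) ∧
      (f (P (i + 1)) - lam (i + 1) * ((P (i + 1)).card : ℝ) ≤
        f X - lam (i + 1) * (X.card : ℝ))) :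
    ∀ σ : α ≃ Fin m,
      ((m : ℝ) + 1) * f Finset.univ -
          ∑ i ∈ Finset.range s,
            (f (P (i + 1)) * ((P i).card : ℝ) - f (P i) * ((P (i + 1)).card : ℝ)) ≤
        2 * ∑ k ∈ Finset.range m, f (prefixSet σ (k + 1)) := by
  intro σ
  have key : ∀ j ≤ s,
      (((P j).card : ℝ) + 1) * f (P j) -
          ∑ i ∈ Finset.range j,
            (f (P (i + 1)) * ((P i).card : ℝ) - f (P i) * ((P (i + 1)).card : ℝ)) ≤
        2 * ∑ k ∈ Finset.range (P j).card, f (prefixSet σ (k + 1)) := by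
    intro j
    induction j with
    | zero =>
      intro _
      simp [hP0, (hzero ∅).2 rfl]
    | succ j ih =>
      intro hj
      have hjs : j < s := hj
      have ihj := ih hjs.le
      have hlt := Finset.card_lt_card (hchain j hjs)
      obtain ⟨d, hd⟩ := Nat.exists_eq_add_of_lt hlt
      have hbm : (P (j + 1)).card ≤ m := hm ▸ Finset.card_le_univ _
      have hdR : ((P (j + 1)).card : ℝ) = (P j).card + ((d + 1 : ℕ) : ℝ) := by
        rw [hd]
        push_cast
        ring
      have hslope : f (P (j + 1)) = f (P j) + lam (j + 1) * ((d + 1 : ℕ) : ℝ) := by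
        have hpos : ((d + 1 : ℕ) : ℝ) ≠ 0 := by positivity
        rw [hlam j hjs, hdR, add_sub_cancel_left, div_mul_cancel₀ _ hpos]
        ring
      have hsum : ∑ k ∈ Finset.range (d + 1), (f (P j) + lam (j + 1) * ((k : ℝ) + 1)) ≤
          ∑ k ∈ Finset.range (d + 1), f (prefixSet σ ((P j).card + k + 1)) := by
        refine Finset.sum_le_sum fun k hk => ?_
        rw [Finset.mem_range] at hk
        have h := (hmin j hjs (prefixSet σ ((P j).card + k + 1))).1
        rw [card_prefixSet σ (by omega)] at h
        push_cast at h
        linarith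
      have haff := two_mul_sum_range_affine (f (P j)) (lam (j + 1)) (d + 1)
      rw [Finset.sum_range_succ, hdR, hd, add_assoc (P j).card d 1, Finset.sum_range_add, hslope]
      rw [mul_add]
      linarith
  have h := key s le_rfl
  rwa [hPs, Finset.card_univ, hm] at h
end

section
/- Let E be a finite set with |E| = m and f : 2^E → ℝ≥0 a nontrivial monotone submodular function with f(∅) = 0, and let κ = max_{x ∈ E} f({x}) > 0. Suppose ∅ = Π_0 ⊊ Π_1 ⊊ ⋯ ⊊ Π_s = E is a nested chain, and σ : E → {1,…,m} is a bijection that is a linear extension of the chain, i.e., E_{|Π_i|,σ} = Π_i for all 1 ≤ i ≤ s. Then ∑_{k=1}^m f(E_{k,σ}) ≤ f(E)·m − f(E)²/(2κ) + f(E)/2 − ∑_{i=1}^s (f(E) − f(Π_i))·(|Π_i| − |Π_{i−1}|) + ∑_{i=1}^s f(Π_{i−1})·(f(Π_i) − f(Π_{i−1}))/κ. -/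
/-- The sum of a nondecreasing sequence with increments at most `κ`, compared with an upper
bound `B` of its last term. -/
theorem sum_range_le_of_increment_le {g : ℕ → ℝ} {κ : ℝ} (hκ : 0 < κ) (hg : Monotone g)
    (hinc : ∀ k, g (k + 1) - g k ≤ κ) (a : ℕ) (B : ℝ) (n : ℕ) (hB : g (a + n) ≤ B) :
    ∑ k ∈ Finset.range n, g (a + k + 1) ≤
      B * n - ((B - g a) ^ 2 - (B - g (a + n)) ^ 2) / (2 * κ) + (g (a + n) - g a) / 2 := by
  induction n with
  | zero => simp
  | succ n ih =>
    have hstep : g (a + n) ≤ g (a + n + 1) := hg (Nat.le_succ _)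
    have hB' : g (a + n + 1) ≤ B := hB
    have ih := ih (hstep.trans hB')
    have hd := hinc (a + n)
    rw [Finset.sum_range_succ, ← add_assoc a n 1]
    push_cast
    have key : ((B - g (a + n)) ^ 2 - (B - g (a + n + 1)) ^ 2) / (2 * κ) ≤
        B - g (a + n + 1) + (g (a + n + 1) - g (a + n)) / 2 := by
      rw [div_le_iff₀ (by positivity)]
      nlinarith [mul_nonneg (sub_nonneg.2 hB') (sub_nonneg.2 hd),
        mul_nonneg (sub_nonneg.2 hstep) (sub_nonneg.2 hd)]
    have split : ((B - g a) ^ 2 - (B - g (a + n + 1)) ^ 2) / (2 * κ) =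
        ((B - g a) ^ 2 - (B - g (a + n)) ^ 2) / (2 * κ) +
          ((B - g (a + n)) ^ 2 - (B - g (a + n + 1)) ^ 2) / (2 * κ) := by ring
    rw [split]
    linarith

theorem sum_range_le_of_breakpoints {g : ℕ → ℝ} {κ : ℝ} (hκ : 0 < κ) (hg : Monotone g)
    (hinc : ∀ k, g (k + 1) - g k ≤ κ) (hg0 : g 0 = 0) {c : ℕ → ℕ} (hc0 : c 0 = 0) (F : ℝ)
    (s : ℕ) (hc : ∀ i < s, c i ≤ c (i + 1)) :
    ∑ k ∈ Finset.range (c s), g (k + 1) ≤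
      F * c s - g (c s) ^ 2 / (2 * κ) + g (c s) / 2 -
        (∑ i ∈ Finset.range s, (F - g (c (i + 1))) * ((c (i + 1) : ℝ) - c i)) +
        ∑ i ∈ Finset.range s, g (c i) * (g (c (i + 1)) - g (c i)) / κ := by
  induction s with
  | zero => simp [hc0, hg0]
  | succ s ih =>
    have ih := ih fun i hi => hc i (by omega)
    obtain ⟨L, hL⟩ := Nat.exists_eq_add_of_le (hc s (by omega))
    have block := sum_range_le_of_increment_le hκ hg hinc (c s) (g (c s + L)) L le_rfl
    rw [Finset.sum_range_succ _ s, Finset.sum_range_succ _ s, hL, Finset.sum_range_add]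
    push_cast
    have split : g (c s + L) ^ 2 / (2 * κ) = g (c s) ^ 2 / (2 * κ) +
        ((g (c s + L) - g (c s)) ^ 2 - (g (c s + L) - g (c s + L)) ^ 2) / (2 * κ) +
          g (c s) * (g (c s + L) - g (c s)) / κ := by
      field_simp
      ring
    rw [split]
    linarith

theorem prefixSet_mono_s10 {α : Type*} [Fintype α] [DecidableEq α] {m : ℕ} (σ : α ≃ Fin m) :
    Monotone (prefixSet σ) := fun _ _ hij _ he => by
  simp only [prefixSet, Finset.mem_filter, Finset.mem_univ, true_and] at he ⊢
  omega

theorem prefixSet_succ_s10 {α : Type*} [Fintype α] [DecidableEq α] {m : ℕ} (σ : α ≃ Fin m)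
    {k : ℕ} (hk : k < m) : prefixSet σ (k + 1) = prefixSet σ k ∪ {σ.symm ⟨k, hk⟩} := by
  ext e
  simp only [prefixSet, Finset.mem_filter, Finset.mem_univ, true_and, Finset.mem_union,
    Finset.mem_singleton, Equiv.eq_symm_apply, Fin.ext_iff]
  omega

theorem prefixSet_eq_univ {α : Type*} [Fintype α] [DecidableEq α] {m : ℕ} (σ : α ≃ Fin m)
    {k : ℕ} (hk : m ≤ k) : prefixSet σ k = Finset.univ :=
  Finset.filter_true_of_mem fun e _ => (σ e).isLt.trans_le hk

theorem stmt_10 {α : Type*} [Fintype α] [DecidableEq α] {m s : ℕ}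
    (hm : Fintype.card α = m) (f : Finset α → ℝ)
    (hnn : ∀ S : Finset α, 0 ≤ f S)
    (hmono : ∀ S T : Finset α, S ⊆ T → f S ≤ f T)
    (hsub : ∀ S T : Finset α, f (S ∪ T) + f (S ∩ T) ≤ f S + f T)
    (hzero : f ∅ = 0) (hnontriv : f Finset.univ ≠ 0)
    (κ : ℝ) (hκub : ∀ x : α, f {x} ≤ κ) (hκmem : ∃ x : α, f {x} = κ) (hκpos : 0 < κ)
    (hs : 1 ≤ s) (P : ℕ → Finset α)
    (hP0 : P 0 = ∅) (hPs : P s = Finset.univ)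
    (hchain : ∀ i < s, P i ⊂ P (i + 1))
    (σ : α ≃ Fin m)
    (hlin : ∀ i : ℕ, 1 ≤ i → i ≤ s → prefixSet σ ((P i).card) = P i) :
    ∑ k ∈ Finset.range m, f (prefixSet σ (k + 1)) ≤
      f Finset.univ * (m : ℝ) - (f Finset.univ) ^ 2 / (2 * κ) + f Finset.univ / 2 -
        (∑ i ∈ Finset.range s,
          (f Finset.univ - f (P (i + 1))) * (((P (i + 1)).card : ℝ) - ((P i).card : ℝ))) +
        ∑ i ∈ Finset.range s, f (P i) * (f (P (i + 1)) - f (P i)) / κ := by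
  have hg : Monotone fun k => f (prefixSet σ k) :=
    fun i j hij => hmono _ _ (prefixSet_mono_s10 σ hij)
  have hg0 : f (prefixSet σ 0) = 0 := by simpa [prefixSet] using hzero
  have hinc : ∀ k, f (prefixSet σ (k + 1)) - f (prefixSet σ k) ≤ κ := fun k => by
    by_cases hk : k < m
    · rw [prefixSet_succ_s10 σ hk]
      linarith [hsub (prefixSet σ k) {σ.symm ⟨k, hk⟩}, hκub (σ.symm ⟨k, hk⟩),
        hnn (prefixSet σ k ∩ {σ.symm ⟨k, hk⟩})]
    · rw [prefixSet_eq_univ σ (by omega : m ≤ k), prefixSet_eq_univ σ (by omega : m ≤ k + 1)]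
      linarith
  have hP : ∀ i ≤ s, f (prefixSet σ (P i).card) = f (P i) := fun i hi => by
    rcases Nat.eq_zero_or_pos i with rfl | hpos
    · simp [hP0, hg0, hzero]
    · rw [hlin i hpos hi]
  have main := sum_range_le_of_breakpoints hκpos hg hinc hg0 (c := fun i => (P i).card)
    (by simp [hP0]) (f Finset.univ) s fun i hi => Finset.card_le_card (hchain i hi).subset
  have hsum₁ := Finset.sum_congr (rfl : Finset.range s = Finset.range s) fun i hi =>
    congrArg (fun t => (f Finset.univ - t) * (((P (i + 1)).card : ℝ) - (P i).card))
      (hP (i + 1) (Finset.mem_range.1 hi))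
  have hsum₂ := Finset.sum_congr (rfl : Finset.range s = Finset.range s) fun i hi =>
    congrArg₂ (fun a b => a * (b - a) / κ) (hP i (Finset.mem_range.1 hi).le)
      (hP (i + 1) (Finset.mem_range.1 hi))
  simp only [hsum₁, hsum₂, hPs, Finset.card_univ, hm, prefixSet_eq_univ σ le_rfl] at main
  exact main
end
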